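/- arXiv:1106.3948 — 2 statements merged into one kernel-verified Lean document; each statement's English description precedes it below -/
import Mathlib

section
/- (Ramanujan's notebook, Part III, Entry 9.) For every complex number q with |q| < 1 (equivalently, as an identity of formal power series in q): ∑_{k=0}^∞ (−1)^k q^{k(k+1)/2} = (q;q)_∞ · ∑_{k=0}^∞ q^{k^2+k} / ((q;q)_k)^2. -/
open Filter Topology Finset

/-- The finite `q`-Pochhammer symbol `(q;q)_n`. -/
def qPochhammer (q : ℂ) (n : ℕ) : ℂ := ∏ j ∈ range n, (1 - q ^ (j + 1))

@[simp] lemma qPochhammer_zero (q : ℂ) : qPochhammer q 0 = 1 := by simp [qPochhammer]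

lemma qPochhammer_succ (q : ℂ) (n : ℕ) :
    qPochhammer q (n + 1) = qPochhammer q n * (1 - q ^ (n + 1)) := prod_range_succ _ _

lemma triangular_succ (n : ℕ) : (n + 1) * (n + 1 + 1) / 2 = n * (n + 1) / 2 + (n + 1) := by
  rw [show (n + 1) * (n + 1 + 1) = n * (n + 1) + 2 * (n + 1) by ring,
    Nat.add_mul_div_left _ _ two_pos]

lemma triangular_add (n m : ℕ) :
    (n + m) * (n + m + 1) / 2 = n * (n + 1) / 2 + m * (m + 1) / 2 + n * m := by
  induction m with
  | zero => simp
  | succ m ih => rw [← add_assoc, triangular_succ, triangular_succ, ih]; ring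

lemma triangular_add_self (n : ℕ) : n * (n + 1) / 2 + n * (n + 1) / 2 = n ^ 2 + n := by
  induction n with
  | zero => simp
  | succ n ih => rw [triangular_succ]; linarith

section

variable {q : ℂ}

lemma one_sub_norm_le_norm_one_sub_pow (hq : ‖q‖ < 1) (n : ℕ) : 1 - ‖q‖ ≤ ‖1 - q ^ (n + 1)‖ := by
  have h1 : ‖q‖ ^ (n + 1) ≤ ‖q‖ := pow_le_of_le_one (norm_nonneg q) hq.le n.succ_ne_zero
  have h2 := norm_sub_norm_le (1 : ℂ) (q ^ (n + 1))
  rw [norm_one, norm_pow] at h2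
  linarith

lemma one_sub_pow_ne_zero (hq : ‖q‖ < 1) (n : ℕ) : 1 - q ^ (n + 1) ≠ 0 :=
  norm_pos_iff.1 ((sub_pos.2 hq).trans_le (one_sub_norm_le_norm_one_sub_pow hq n))

lemma qPochhammer_ne_zero (hq : ‖q‖ < 1) (n : ℕ) : qPochhammer q n ≠ 0 :=
  prod_ne_zero_iff.2 fun j _ => one_sub_pow_ne_zero hq j

lemma norm_qPochhammer_inv_le (hq : ‖q‖ < 1) (n : ℕ) :
    ‖(qPochhammer q n)⁻¹‖ ≤ (1 - ‖q‖)⁻¹ ^ n := by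
  have h := sub_pos.2 hq
  rw [norm_inv, inv_pow]
  refine inv_anti₀ (pow_pos h n) ?_
  rw [qPochhammer, norm_prod]
  simpa using prod_le_prod (s := range n) (fun _ _ => h.le)
    fun j _ => one_sub_norm_le_norm_one_sub_pow hq j

lemma summable_pow_triangular_mul_pow {r : ℝ} (h0 : 0 ≤ r) (h1 : r < 1) {D : ℝ} (hD : 0 ≤ D) :
    Summable fun n : ℕ => r ^ (n * (n + 1) / 2) * D ^ n := by
  have hlim : Tendsto (fun n : ℕ => r ^ (n + 1) * D) atTop (𝓝 0) := by
    simpa using ((tendsto_pow_atTop_nhds_zero_of_lt_one h0 h1).comp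
      (tendsto_add_atTop_nat 1)).mul_const D
  refine summable_of_ratio_norm_eventually_le (r := 1 / 2) (by norm_num) ?_
  filter_upwards [hlim.eventually_le_const (show (0 : ℝ) < 1 / 2 by norm_num)] with n hn
  rw [Real.norm_of_nonneg (by positivity), Real.norm_of_nonneg (by positivity), triangular_succ,
    pow_add, pow_succ D]
  calc _ = r ^ (n + 1) * D * (r ^ (n * (n + 1) / 2) * D ^ n) := by ring
    _ ≤ _ := by gcongr

/-- The general term of Euler's series for `(zq;q)_∞`. -/
noncomputable def eulerTerm (q z : ℂ) (m : ℕ) : ℂ := q ^ (m * (m + 1) / 2) * (-z) ^ m / qPochhammer q m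

lemma norm_eulerTerm_le (hq : ‖q‖ < 1) {z : ℂ} (hz : ‖z‖ ≤ 1) (m : ℕ) :
    ‖eulerTerm q z m‖ ≤ ‖q‖ ^ (m * (m + 1) / 2) * (1 - ‖q‖)⁻¹ ^ m := by
  rw [eulerTerm, div_eq_mul_inv, norm_mul, norm_mul, norm_pow, norm_pow, norm_neg]
  gcongr
  · exact mul_le_of_le_one_right (by positivity) (pow_le_one₀ (norm_nonneg z) hz)
  · exact norm_qPochhammer_inv_le hq m

lemma summable_eulerTerm_bound (hq : ‖q‖ < 1) :
    Summable fun m : ℕ => ‖q‖ ^ (m * (m + 1) / 2) * (1 - ‖q‖)⁻¹ ^ m :=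
  summable_pow_triangular_mul_pow (norm_nonneg q) hq (inv_nonneg.2 (sub_pos.2 hq).le)

lemma summable_eulerTerm (hq : ‖q‖ < 1) {z : ℂ} (hz : ‖z‖ ≤ 1) : Summable (eulerTerm q z) :=
  (summable_eulerTerm_bound hq).of_norm_bounded (norm_eulerTerm_le hq hz)

lemma eulerTerm_succ_mul (hq : ‖q‖ < 1) (z : ℂ) (m : ℕ) :
    eulerTerm q z (m + 1) * (1 - q ^ (m + 1)) = -(z * q) * eulerTerm q (z * q) m := by
  have h1 := qPochhammer_ne_zero hq m
  have h2 := one_sub_pow_ne_zero hq m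
  rw [eulerTerm, eulerTerm, triangular_succ, qPochhammer_succ]
  field_simp
  ring

lemma eulerTerm_mul_right (z : ℂ) (m : ℕ) :
    eulerTerm q (z * q) m = eulerTerm q z m * q ^ m := by
  rw [eulerTerm, eulerTerm, ← neg_mul, mul_pow]
  ring

lemma tsum_eulerTerm_eq (hq : ‖q‖ < 1) {z : ℂ} (hz : ‖z‖ ≤ 1) :
    ∑' m, eulerTerm q z m = (1 - z * q) * ∑' m, eulerTerm q (z * q) m := by
  have hzq : ‖z * q‖ ≤ 1 := by
    rw [norm_mul]; exact mul_le_one₀ hz (norm_nonneg q) hq.le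
  have h1 := summable_eulerTerm hq hz
  have h2 := summable_eulerTerm hq hzq
  have h : ∑' m, (eulerTerm q z m - eulerTerm q (z * q) m) =
      -(z * q) * ∑' m, eulerTerm q (z * q) m := by
    rw [(h1.sub h2).tsum_eq_zero_add, ← tsum_mul_left]
    simp only [eulerTerm_mul_right z, ← mul_one_sub]
    simp only [eulerTerm_succ_mul hq, eulerTerm_mul_right]
    simp
  rw [h1.tsum_sub h2] at h
  linear_combination h

lemma tendsto_tsum_eulerTerm_pow (hq : ‖q‖ < 1) :
    Tendsto (fun n : ℕ => ∑' m, eulerTerm q (q ^ n) m) atTop (𝓝 1) := by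
  have h0 : ∑' m, eulerTerm q 0 m = 1 := by
    rw [tsum_eq_single 0 fun m hm => by simp [eulerTerm, hm]]
    simp [eulerTerm]
  rw [← h0]
  refine tendsto_tsum_of_dominated_convergence (summable_eulerTerm_bound hq) (fun m => ?_)
    (Eventually.of_forall fun n => norm_eulerTerm_le hq ?_)
  · have h : Continuous fun z => eulerTerm q z m := by unfold eulerTerm; fun_prop
    exact (h.tendsto 0).comp (tendsto_pow_atTop_nhds_zero_of_norm_lt_one hq)
  · rw [norm_pow]; exact pow_le_one₀ (norm_nonneg q) hq.le

lemma qPochhammer_mul_tsum_eulerTerm (hq : ‖q‖ < 1) (n : ℕ) :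
    qPochhammer q n * ∑' m, eulerTerm q (q ^ n) m = ∑' m, eulerTerm q 1 m := by
  induction n with
  | zero => simp
  | succ n ih =>
    have hn : ‖q ^ n‖ ≤ 1 := by rw [norm_pow]; exact pow_le_one₀ (norm_nonneg q) hq.le
    rw [← ih, tsum_eulerTerm_eq hq hn, ← pow_succ, qPochhammer_succ]
    ring

lemma tendsto_qPochhammer (hq : ‖q‖ < 1) :
    Tendsto (qPochhammer q) atTop (𝓝 (∏' j : ℕ, (1 - q ^ (j + 1)))) := by
  have h : Multipliable fun j : ℕ => 1 + -q ^ (j + 1) := by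
    refine multipliable_one_add_of_summable ?_
    simp only [norm_neg, norm_pow]
    exact (summable_nat_add_iff 1).2 (summable_geometric_of_lt_one (norm_nonneg q) hq)
  simp only [← sub_eq_add_neg] at h
  exact h.hasProd.tendsto_prod_nat

/-- Euler's expansion of `(q^{n+1};q)_∞ = (q;q)_∞ / (q;q)_n`. -/
lemma tsum_eulerTerm_pow (hq : ‖q‖ < 1) (n : ℕ) :
    ∑' m, eulerTerm q (q ^ n) m = (∏' j : ℕ, (1 - q ^ (j + 1))) / qPochhammer q n := by
  have h := (tendsto_qPochhammer hq).mul (tendsto_tsum_eulerTerm_pow hq)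
  simp only [qPochhammer_mul_tsum_eulerTerm hq, mul_one] at h
  rw [eq_div_iff (qPochhammer_ne_zero hq n), mul_comm, qPochhammer_mul_tsum_eulerTerm hq]
  exact tendsto_nhds_unique tendsto_const_nhds h

/-- The finite `q`-binomial theorem. -/
lemma sum_antidiagonal_eulerTerm_div (hq : ‖q‖ < 1) (N : ℕ) (z : ℂ) :
    ∑ p ∈ antidiagonal N, eulerTerm q z p.1 / qPochhammer q p.2 =
      (∏ i ∈ range N, (1 - z * q ^ (i + 1))) / qPochhammer q N := by
  induction N generalizing z with
  | zero => simp [eulerTerm]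
  | succ N ih =>
    have key : (1 - q ^ (N + 1)) *
        ∑ p ∈ antidiagonal (N + 1), eulerTerm q z p.1 / qPochhammer q p.2 =
        (1 - z * q) * ∑ p ∈ antidiagonal N, eulerTerm q (z * q) p.1 / qPochhammer q p.2 := by
      have hsplit : (1 - q ^ (N + 1)) *
          ∑ p ∈ antidiagonal (N + 1), eulerTerm q z p.1 / qPochhammer q p.2 =
          ∑ p ∈ antidiagonal (N + 1),
            eulerTerm q (z * q) p.1 * ((1 - q ^ p.2) / qPochhammer q p.2) +
          ∑ p ∈ antidiagonal (N + 1),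
            eulerTerm q z p.1 * (1 - q ^ p.1) / qPochhammer q p.2 := by
        rw [mul_sum, ← sum_add_distrib]
        refine sum_congr rfl fun p hp => ?_
        rw [← mem_antidiagonal.1 hp, eulerTerm_mul_right, pow_add]
        ring
      have hcancel (m : ℕ) :
          (1 - q ^ (m + 1)) / qPochhammer q (m + 1) = (qPochhammer q m)⁻¹ := by
        have h1 := qPochhammer_ne_zero hq m
        have h2 := one_sub_pow_ne_zero hq m
        rw [qPochhammer_succ]
        field_simp
      rw [hsplit, Nat.sum_antidiagonal_succ', Nat.sum_antidiagonal_succ]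
      simp only [eulerTerm_succ_mul hq, hcancel]
      simp only [pow_zero, sub_self, zero_div, mul_zero, zero_add, ← div_eq_mul_inv,
        mul_div_assoc, ← mul_sum]
      ring
    have hprod : ∏ i ∈ range (N + 1), (1 - z * q ^ (i + 1)) =
        (1 - z * q) * ∏ i ∈ range N, (1 - z * q * q ^ (i + 1)) := by
      rw [prod_range_succ', mul_comm]
      simp only [zero_add, pow_one]
      congr 1
      exact prod_congr rfl fun i _ => by ring
    refine mul_left_cancel₀ (one_sub_pow_ne_zero hq N) ?_
    have h1 := qPochhammer_ne_zero hq N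
    have h2 := one_sub_pow_ne_zero hq N
    rw [key, ih, hprod, qPochhammer_succ]
    field_simp

/-- The double series whose iterated sums give the two sides of Entry 9. -/
noncomputable def entryNineTerm (q : ℂ) (p : ℕ × ℕ) : ℂ :=
  q ^ (p.1 ^ 2 + p.1) / qPochhammer q p.1 * eulerTerm q (q ^ p.1) p.2

lemma summable_entryNineTerm (hq : ‖q‖ < 1) : Summable (entryNineTerm q) := by
  have hb := summable_eulerTerm_bound hq
  have h0 : 0 ≤ (1 - ‖q‖)⁻¹ := inv_nonneg.2 (sub_pos.2 hq).le
  refine (hb.mul_of_nonneg hb (fun _ => by positivity)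
    (fun _ => by positivity)).of_norm_bounded fun p => ?_
  rw [entryNineTerm, norm_mul, div_eq_mul_inv, norm_mul, norm_pow]
  gcongr ?_ * ?_ * ?_
  · exact pow_le_pow_of_le_one (norm_nonneg q) hq.le
      (by rw [← triangular_add_self]; exact Nat.le_add_left _ _)
  · exact norm_qPochhammer_inv_le hq _
  · refine norm_eulerTerm_le hq ?_ _
    rw [norm_pow]; exact pow_le_one₀ (norm_nonneg q) hq.le

lemma entryNineTerm_eq (n m : ℕ) :
    entryNineTerm q (n, m) = (-1) ^ (n + m) * q ^ ((n + m) * (n + m + 1) / 2) *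
      (eulerTerm q 1 n / qPochhammer q m) := by
  have h : ((-1 : ℂ) ^ n) * (-1) ^ n = 1 := by rw [← mul_pow]; simp
  simp only [entryNineTerm, eulerTerm]
  rw [triangular_add, ← triangular_add_self, neg_pow (q ^ n), ← pow_mul]
  simp only [pow_add]
  linear_combination (-(q ^ (n * (n + 1) / 2) * q ^ (n * (n + 1) / 2) * q ^ (m * (m + 1) / 2) *
    q ^ (n * m) * (-1) ^ m / (qPochhammer q n * qPochhammer q m))) * h

lemma sum_antidiagonal_entryNineTerm (hq : ‖q‖ < 1) (N : ℕ) :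
    ∑ p ∈ antidiagonal N, entryNineTerm q p = (-1) ^ N * q ^ (N * (N + 1) / 2) := by
  have h := sum_antidiagonal_eulerTerm_div hq N 1
  simp only [one_mul] at h
  rw [← qPochhammer, div_self (qPochhammer_ne_zero hq N)] at h
  refine Eq.trans ?_ (mul_one _)
  conv_rhs => arg 2; rw [← h]
  rw [mul_sum]
  refine sum_congr rfl fun p hp => ?_
  rw [← mem_antidiagonal.1 hp, ← entryNineTerm_eq]

end

/-- **Ramanujan's notebook, Part III, Entry 9.** For every complex `q` with `|q| < 1`:
`∑_{k=0}^∞ (−1)^k q^{k(k+1)/2} = (q;q)_∞ · ∑_{k=0}^∞ q^{k²+k} / ((q;q)_k)²`. -/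
theorem ramanujan_entry9 (q : ℂ) (hq : ‖q‖ < 1) :
    ∑' k : ℕ, (-1 : ℂ) ^ k * q ^ (k * (k + 1) / 2) =
      (∏' j : ℕ, (1 - q ^ (j + 1))) *
        ∑' k : ℕ, q ^ (k ^ 2 + k) / (∏ j ∈ Finset.range k, (1 - q ^ (j + 1))) ^ 2 := by
  have hs := summable_entryNineTerm hq
  have hs' := (HasAntidiagonal.sigmaAntidiagonalEquivProd (A := ℕ)).summable_iff.2 hs
  calc _ = ∑' N, ∑ p ∈ antidiagonal N, entryNineTerm q p := by
        simp only [sum_antidiagonal_entryNineTerm hq]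
    _ = ∑' p, entryNineTerm q p := by
        rw [← (HasAntidiagonal.sigmaAntidiagonalEquivProd (A := ℕ)).tsum_eq (entryNineTerm q)]
        refine Eq.trans (tsum_congr fun N => ?_) hs'.tsum_sigma.symm
        exact (Finset.tsum_subtype (antidiagonal N) (entryNineTerm q)).symm
    _ = ∑' n, ∑' m, entryNineTerm q (n, m) := hs.tsum_prod
    _ = _ := by
        rw [← tsum_mul_left]
        refine tsum_congr fun n => ?_
        simp only [entryNineTerm]
        rw [tsum_mul_left, tsum_eulerTerm_pow hq, ← qPochhammer]
        ring
end

section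
/- (Jacobi triple product identity.) For all complex numbers x, y with |x| < 1 and y ≠ 0: ∑_{m∈ℤ} x^{m^2} y^{2m} = ∏_{n=1}^∞ (1−x^{2n}) (1+x^{2n−1} y^2) (1+x^{2n−1} y^{−2}). -/
/-- The reciprocal `1 / ∏_{k=1}^n (1 - q^k)`, extended by zero to negative `n`. -/
noncomputable def invQFactorial (q : ℂ) : ℤ → ℂ
  | .ofNat n => (∏ k ∈ Finset.range n, (1 - q ^ (k + 1)))⁻¹
  | .negSucc _ => 0

lemma one_sub_pow_succ_ne_zero {q : ℂ} (hq : ‖q‖ < 1) (k : ℕ) : 1 - q ^ (k + 1) ≠ 0 := by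
  intro h
  have h1 : ‖q ^ (k + 1)‖ < 1 := by
    rw [norm_pow]
    exact pow_lt_one₀ (norm_nonneg q) hq k.succ_ne_zero
  rw [← sub_eq_zero.mp h, norm_one] at h1
  exact lt_irrefl _ h1

lemma invQFactorial_natCast (q : ℂ) (n : ℕ) :
    invQFactorial q n = (∏ k ∈ Finset.range n, (1 - q ^ (k + 1)))⁻¹ := rfl

lemma invQFactorial_of_neg (q : ℂ) {n : ℤ} (hn : n < 0) : invQFactorial q n = 0 := by
  obtain ⟨k, rfl⟩ := Int.eq_negSucc_of_lt_zero hn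
  rfl

lemma invQFactorial_sub_one {q : ℂ} (hq : ‖q‖ < 1) (n : ℤ) :
    invQFactorial q (n - 1) = (1 - q ^ n) * invQFactorial q n := by
  rcases lt_trichotomy n 0 with hn | rfl | hn
  · rw [invQFactorial_of_neg q hn, invQFactorial_of_neg q (by lia), mul_zero]
  · rw [invQFactorial_of_neg q (by lia), zpow_zero, sub_self, zero_mul]
  · obtain ⟨k, rfl⟩ : ∃ k : ℕ, n = (k + 1 : ℕ) := ⟨(n - 1).toNat, by lia⟩
    rw [show ((k + 1 : ℕ) : ℤ) - 1 = (k : ℕ) by lia, invQFactorial_natCast, invQFactorial_natCast,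
      zpow_natCast, Finset.prod_range_succ, mul_inv, mul_left_comm,
      mul_inv_cancel₀ (one_sub_pow_succ_ne_zero hq k), mul_one]

/-- The finite form of the triple product identity, equivalent to the `q`-binomial theorem. -/
lemma hasSum_invQFactorial_mul {x z : ℂ} (hx : ‖x‖ < 1) (hx0 : x ≠ 0) (hz : z ≠ 0) (N : ℕ) :
    HasSum (fun m : ℤ ↦ invQFactorial (x ^ 2) (N - m) * invQFactorial (x ^ 2) (N + m) *
        (x ^ (m ^ 2) * z ^ m))
      (invQFactorial (x ^ 2) (2 * N) *
        ∏ n ∈ Finset.range N, ((1 + x ^ (2 * n + 1) * z) * (1 + x ^ (2 * n + 1) / z))) := by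
  have hq : ‖x ^ 2‖ < 1 := by
    rw [norm_pow]
    exact pow_lt_one₀ (norm_nonneg x) hx two_ne_zero
  induction N with
  | zero =>
    convert hasSum_single (0 : ℤ) ?_ using 1
    · have h0 : invQFactorial (x ^ 2) 0 = 1 := by simpa using invQFactorial_natCast (x ^ 2) 0
      simp [h0]
    · intro m hm
      rcases lt_or_gt_of_ne hm with h | h
      · rw [invQFactorial_of_neg _ (n := ((0 : ℕ) : ℤ) + m) (by lia)]
        ring
      · rw [invQFactorial_of_neg _ (n := ((0 : ℕ) : ℤ) - m) (by lia)]
        ring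
  | succ N ih =>
    have hc1 := one_sub_pow_succ_ne_zero hq (2 * N)
    have hc2 := one_sub_pow_succ_ne_zero hq (2 * N + 1)
    have hdown := ((Equiv.subRight (1 : ℤ)).hasSum_iff.mpr ih).mul_left (x ^ (2 * N + 1) * z)
    have hup := ((Equiv.addRight (1 : ℤ)).hasSum_iff.mpr ih).mul_left (x ^ (2 * N + 1) / z)
    have hmid := ih.mul_left (1 + x ^ (4 * N + 2))
    rw [← hasSum_mul_left_iff (mul_ne_zero hc1 hc2)]
    convert (hmid.add hdown).add hup using 1
    · rfl
    · funext m
      simp only [Function.comp_apply, Equiv.subRight_apply, Equiv.coe_addRight]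
      have e1 := invQFactorial_sub_one hq (N + 1 - m)
      have e2 := invQFactorial_sub_one hq (N + 1 + m)
      have e3 := invQFactorial_sub_one hq (N - m)
      have e4 := invQFactorial_sub_one hq (N + m)
      rw [show (N : ℤ) + 1 - m - 1 = N - m by ring] at e1
      rw [show (N : ℤ) + 1 + m - 1 = N + m by ring] at e2
      rw [e1] at e3
      rw [e2] at e4
      rw [show (N : ℤ) - (m - 1) = N + 1 - m by ring, show (N : ℤ) + (m - 1) = N + m - 1 by ring,
        show (N : ℤ) - (m + 1) = N - m - 1 by ring, show (N : ℤ) + (m + 1) = N + 1 + m by ring,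
        e3, e4, e1, e2, show (m - 1) ^ 2 = m ^ 2 - m - m + 1 by ring,
        show (m + 1) ^ 2 = m ^ 2 + m + m + 1 by ring]
      have hA : x ^ m ≠ 0 := zpow_ne_zero m hx0
      have hZ : z ^ m ≠ 0 := zpow_ne_zero m hz
      have hq0 : x ^ 2 ≠ 0 := pow_ne_zero 2 hx0
      have hqm : (x ^ 2) ^ m = (x ^ m) ^ 2 := by
        rw [← zpow_natCast, ← zpow_natCast, zpow_comm]
      push_cast
      simp only [zpow_add₀ hx0, zpow_sub₀ hx0, zpow_add₀ hz, zpow_sub₀ hz, zpow_add₀ hq0,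
        zpow_sub₀ hq0, hqm, zpow_natCast, zpow_one]
      generalize x ^ m = A at *
      generalize z ^ m = Z at *
      generalize x ^ (m ^ 2) = X at *
      generalize invQFactorial (x ^ 2) (N + 1 - m) = u at *
      generalize invQFactorial (x ^ 2) (N + 1 + m) = v at *
      field_simp
      ring
    · have e1 := invQFactorial_sub_one hq ((2 * N + 1 : ℕ) : ℤ)
      have e2 := invQFactorial_sub_one hq ((2 * N + 1 + 1 : ℕ) : ℤ)
      rw [show ((2 * N + 1 : ℕ) : ℤ) - 1 = 2 * N by lia, zpow_natCast] at e1
      rw [show ((2 * N + 1 + 1 : ℕ) : ℤ) - 1 = (2 * N + 1 : ℕ) by lia, zpow_natCast] at e2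
      rw [e1, e2, Finset.prod_range_succ,
        show (2 : ℤ) * ((N + 1 : ℕ) : ℤ) = (2 * N + 1 + 1 : ℕ) by lia]
      generalize ∏ n ∈ Finset.range N, (1 + x ^ (2 * n + 1) * z) * (1 + x ^ (2 * n + 1) / z) = P
      field_simp
      ring

lemma summable_pow_sq_mul_pow {a b : ℝ} (ha0 : 0 < a) (ha : a < 1) (hb : 0 < b) :
    Summable fun n : ℕ ↦ a ^ (n ^ 2) * b ^ n := by
  refine summable_of_ratio_test_tendsto_lt_one zero_lt_one (.of_forall fun n ↦ by positivity) ?_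
  have h : Filter.Tendsto (fun n : ℕ ↦ (a ^ 2) ^ n * (a * b)) .atTop (nhds (0 * (a * b))) :=
    (tendsto_pow_atTop_nhds_zero_of_lt_one (by positivity)
      (pow_lt_one₀ ha0.le ha two_ne_zero)).mul_const _
  rw [zero_mul] at h
  refine h.congr fun n ↦ ?_
  rw [Real.norm_of_nonneg (by positivity), Real.norm_of_nonneg (by positivity),
    eq_div_iff (by positivity)]
  ring

lemma summable_zpow_sq_mul_zpow {a b : ℝ} (ha0 : 0 < a) (ha : a < 1) (hb : 0 < b) :
    Summable fun m : ℤ ↦ a ^ (m ^ 2) * b ^ m := by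
  refine Summable.of_nat_of_neg ?_ ?_
  · refine (summable_pow_sq_mul_pow ha0 ha hb).congr fun n ↦ ?_
    norm_cast
  · refine (summable_pow_sq_mul_pow ha0 ha (inv_pos.mpr hb)).congr fun n ↦ ?_
    rw [neg_sq, zpow_neg, inv_pow, zpow_natCast]
    norm_cast

lemma summable_norm_pow_succ {q : ℂ} (hq : ‖q‖ < 1) : Summable fun n : ℕ ↦ ‖q ^ (n + 1)‖ := by
  simp only [norm_pow]
  exact (summable_nat_add_iff 1).mpr (summable_geometric_of_lt_one (norm_nonneg q) hq)

lemma multipliable_one_sub_pow_succ {q : ℂ} (hq : ‖q‖ < 1) :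
    Multipliable fun n : ℕ ↦ 1 - q ^ (n + 1) := by
  simpa only [sub_eq_add_neg] using multipliable_one_add_of_summable (f := fun n ↦ -q ^ (n + 1))
    (by simpa only [norm_neg] using summable_norm_pow_succ hq)

lemma tprod_one_sub_pow_succ_ne_zero {q : ℂ} (hq : ‖q‖ < 1) :
    ∏' n : ℕ, (1 - q ^ (n + 1)) ≠ 0 := by
  simpa only [sub_eq_add_neg] using tprod_one_add_ne_zero_of_summable (f := fun n ↦ -q ^ (n + 1))
    (by simpa only [← sub_eq_add_neg] using one_sub_pow_succ_ne_zero hq)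
    (by simpa only [norm_neg] using summable_norm_pow_succ hq)

lemma tendsto_invQFactorial {q : ℂ} (hq : ‖q‖ < 1) :
    Filter.Tendsto (invQFactorial q) .atTop (nhds (∏' n : ℕ, (1 - q ^ (n + 1)))⁻¹) := by
  rw [← Nat.map_cast_int_atTop, Filter.tendsto_map'_iff]
  exact (multipliable_one_sub_pow_succ hq).tendsto_prod_tprod_nat.inv₀
    (tprod_one_sub_pow_succ_ne_zero hq)

lemma exists_norm_invQFactorial_le {q : ℂ} (hq : ‖q‖ < 1) :
    ∃ C, ∀ n, ‖invQFactorial q n‖ ≤ C := by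
  have h : Filter.Tendsto (fun n : ℕ ↦ invQFactorial q n) .atTop _ :=
    (tendsto_invQFactorial hq).comp tendsto_natCast_atTop_atTop
  obtain ⟨C, hC⟩ := h.norm.bddAbove_range
  have hC' (n : ℕ) : ‖invQFactorial q n‖ ≤ C := hC ⟨n, rfl⟩
  refine ⟨C, fun n ↦ ?_⟩
  rcases lt_or_ge n 0 with hn | hn
  · rw [invQFactorial_of_neg q hn, norm_zero]
    exact (norm_nonneg _).trans (hC' 0)
  · lift n to ℕ using hn
    exact hC' n

lemma multipliable_one_add_odd_pow_mul {x : ℂ} (hx : ‖x‖ < 1) (w : ℂ) :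
    Multipliable fun n : ℕ ↦ 1 + x ^ (2 * n + 1) * w := by
  refine multipliable_one_add_of_summable ?_
  have h : Summable fun n : ℕ ↦ (‖x‖ ^ 2) ^ n * (‖x‖ * ‖w‖) :=
    (summable_geometric_of_lt_one (by positivity)
      (pow_lt_one₀ (norm_nonneg x) hx two_ne_zero)).mul_right _
  refine h.congr fun n ↦ ?_
  rw [norm_mul, norm_pow]
  ring

lemma tsum_zpow_sq_mul_zpow {x z : ℂ} (hx : ‖x‖ < 1) (hx0 : x ≠ 0) (hz : z ≠ 0) :
    ∑' m : ℤ, x ^ (m ^ 2) * z ^ m =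
      ∏' n : ℕ, ((1 - (x ^ 2) ^ (n + 1)) *
        ((1 + x ^ (2 * n + 1) * z) * (1 + x ^ (2 * n + 1) / z))) := by
  have hq : ‖x ^ 2‖ < 1 := by
    rw [norm_pow]
    exact pow_lt_one₀ (norm_nonneg x) hx two_ne_zero
  have hmult : Multipliable fun n : ℕ ↦
      (1 + x ^ (2 * n + 1) * z) * (1 + x ^ (2 * n + 1) / z) := by
    simpa only [div_eq_mul_inv] using
      (multipliable_one_add_odd_pow_mul hx z).mul (multipliable_one_add_odd_pow_mul hx z⁻¹)
  rw [(multipliable_one_sub_pow_succ hq).tprod_mul hmult]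
  have hL := tprod_one_sub_pow_succ_ne_zero hq
  have hlim := tendsto_invQFactorial hq
  set L := ∏' n : ℕ, (1 - (x ^ 2) ^ (n + 1))
  obtain ⟨C, hC⟩ := exists_norm_invQFactorial_le hq
  have hsum : Filter.Tendsto (fun N : ℕ ↦ ∑' m : ℤ, invQFactorial (x ^ 2) (N - m) *
      invQFactorial (x ^ 2) (N + m) * (x ^ (m ^ 2) * z ^ m)) .atTop
      (nhds (∑' m : ℤ, L⁻¹ * L⁻¹ * (x ^ (m ^ 2) * z ^ m))) := by
    refine tendsto_tsum_of_dominated_convergence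
      (bound := fun m : ℤ ↦ C * C * (‖x‖ ^ (m ^ 2) * ‖z‖ ^ m))
      ((summable_zpow_sq_mul_zpow (norm_pos_iff.mpr hx0) hx (norm_pos_iff.mpr hz)).mul_left _)
      (fun m ↦ ?_) (.of_forall fun N m ↦ ?_)
    · refine Filter.Tendsto.mul_const _ (.mul (hlim.comp ?_) (hlim.comp ?_))
      · exact Filter.tendsto_atTop_add_const_right _ (-m) tendsto_natCast_atTop_atTop
      · exact Filter.tendsto_atTop_add_const_right _ m tendsto_natCast_atTop_atTop
    · rw [norm_mul, norm_mul, norm_mul, norm_zpow, norm_zpow]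
      have hC0 : 0 ≤ C := (norm_nonneg _).trans (hC 0)
      gcongr
      · exact hC _
      · exact hC _
  have hprod := (hlim.comp ((tendsto_natCast_atTop_atTop (R := ℤ)).const_mul_atTop'
    (two_pos : (0 : ℤ) < 2))).mul hmult.tendsto_prod_tprod_nat
  have key := tendsto_nhds_unique
    (hsum.congr fun N ↦ (hasSum_invQFactorial_mul hx hx0 hz N).tsum_eq) hprod
  rw [tsum_mul_left, mul_assoc] at key
  exact (inv_mul_eq_iff_eq_mul₀ hL).mp (mul_left_cancel₀ (inv_ne_zero hL) key)

/-- **The Jacobi triple product identity.** For complex `x, y` with `|x| < 1` and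
`y ≠ 0`:
`∑_{m∈ℤ} x^{m²} y^{2m} = ∏_{n=1}^∞ (1−x^{2n})(1+x^{2n−1}y²)(1+x^{2n−1}y^{−2})`. -/
theorem jacobi_triple_product (x y : ℂ) (hx : ‖x‖ < 1) (hy : y ≠ 0) :
    ∑' m : ℤ, x ^ (m ^ 2) * y ^ (2 * m) =
      ∏' n : ℕ,
        ((1 - x ^ (2 * (n + 1))) * (1 + x ^ (2 * (n + 1) - 1) * y ^ 2) *
          (1 + x ^ (2 * (n + 1) - 1) / y ^ 2)) := by
  have hodd (n : ℕ) : 2 * (n + 1) - 1 = 2 * n + 1 := by lia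
  simp only [hodd]
  rcases eq_or_ne x 0 with rfl | hx0
  · rw [tsum_eq_single 0 fun m hm ↦ by rw [zero_zpow _ (pow_ne_zero 2 hm), zero_mul]]
    simp
  · simpa only [zpow_mul, zpow_ofNat, pow_mul, mul_assoc] using
      tsum_zpow_sq_mul_zpow hx hx0 (pow_ne_zero 2 hy)
end
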